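/- Let 𝒳 be a set and σ : 𝒳 → 𝒳 a confined self-map. Assume Λ is finite with Λ > 1 and that the Cesàro mean B := 𝒞(σ_k/Λ^k) exists and is strictly positive. Let g : 𝒩 → ℝ be a strongly additive function. Set k_X := X/exp((log X)^{1/4}), k̃_X := X^{1/log log X}, and for C > 0 let 𝒜(X,C) := {P ∈ 𝒫 : (k_X ≤ ℓ(P) ≤ X or ℓ(P) < k̃_X) and |g(P)| ≤ C}. Then for every C > 0 and every ε > 0, limsup_{X→∞} (1/(B log X)) · log ℙ_X[ | Σ_{P ∈ 𝒜(X,C), P ∣ O} g(P) | ≥ ε B log X ] = −∞. -/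

import Mathlib

open Filter Topology Real MeasureTheory Asymptotics
open scoped Classical

noncomputable section

/-- `σ` is confined: every iterate has only finitely many fixed points. -/
def Confined {𝒳 : Type*} (σ : 𝒳 → 𝒳) : Prop :=
  ∀ k : ℕ, 1 ≤ k → {x : 𝒳 | σ^[k] x = x}.Finite

/-- `σ_k`: the number of fixed points of the `k`-th iterate of `σ`. -/
def fixCount {𝒳 : Type*} (σ : 𝒳 → 𝒳) (k : ℕ) : ℕ :=
  Nat.card {x : 𝒳 // σ^[k] x = x}

/-- A prime orbit: a finite set of the form `{x, σ x, …, σ^[ℓ-1] x}` of cardinality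
exactly `ℓ ≥ 1`, mapped to itself by `σ`. -/
def IsPrimeOrbit {𝒳 : Type*} (σ : 𝒳 → 𝒳) (P : Set 𝒳) : Prop :=
  ∃ (x : 𝒳) (ℓ : ℕ), 0 < ℓ ∧ P = (fun i => σ^[i] x) '' Set.Iio ℓ ∧ P.ncard = ℓ ∧ σ '' P = P

/-- The type of prime orbits of `σ`. -/
def PrimeOrbit {𝒳 : Type*} (σ : 𝒳 → 𝒳) := {P : Set 𝒳 // IsPrimeOrbit σ P}

/-- The length `ℓ(P)` of a prime orbit. -/
def orbitLen {𝒳 : Type*} {σ : 𝒳 → 𝒳} (P : PrimeOrbit σ) : ℕ := P.1.ncard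

/-- General orbits: elements of the free abelian monoid on the prime orbits,
i.e. finitely supported multisets of prime orbits. -/
abbrev GenOrbit {𝒳 : Type*} (σ : 𝒳 → 𝒳) := PrimeOrbit σ →₀ ℕ

/-- The length of a general orbit: sum of the lengths of its prime components,
with multiplicity. -/
def genLen {𝒳 : Type*} {σ : 𝒳 → 𝒳} (O : GenOrbit σ) : ℕ :=
  O.sum fun P m => m * orbitLen P

/-- `N_σ(X)`: the number of general orbits of length at most `X`. -/
def Ncount {𝒳 : Type*} (σ : 𝒳 → 𝒳) (X : ℕ) : ℕ :=
  Nat.card {O : GenOrbit σ // genLen O ≤ X}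

/-- `P_ℓ`: the number of prime orbits of length `ℓ`. -/
def Pcount {𝒳 : Type*} (σ : 𝒳 → 𝒳) (ℓ : ℕ) : ℕ :=
  Nat.card {P : PrimeOrbit σ // orbitLen P = ℓ}

/-- The Mertens-type counting function `M_σ(X) = Σ_{1 ≤ ℓ ≤ X} P_ℓ Λ^{-ℓ}`. -/
def Mfun {𝒳 : Type*} (σ : 𝒳 → 𝒳) (Λ : ℝ) (X : ℕ) : ℝ :=
  ∑ ℓ ∈ Finset.Icc 1 X, (Pcount σ ℓ : ℝ) / Λ ^ ℓ

/-- The Cesàro mean of the real sequence `a` (indexed from `1`) equals `B`. -/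
def CesaroLim (a : ℕ → ℝ) (B : ℝ) : Prop :=
  Tendsto (fun X : ℕ => (∑ k ∈ Finset.Icc 1 X, a k) / (X : ℝ)) atTop (𝓝 B)

/-- Extended-real logarithm, sending `0` (and negative numbers) to `-∞`. -/
def elog (x : ℝ) : EReal := if x ≤ 0 then ⊥ else ((Real.log x : ℝ) : EReal)

/-- The sequence `log(σ_k)/k`, with values in the extended reals
(so that `σ_k = 0` contributes `-∞`). -/
def growthSeq {𝒳 : Type*} (σ : 𝒳 → 𝒳) (k : ℕ) : EReal :=
  elog (fixCount σ k) * ((((k : ℝ)⁻¹ : ℝ)) : EReal)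

/-- The growth rate of `σ` is the (finite) real number `Λ`, i.e.
`limsup_{k→∞} log(σ_k)/k = log Λ` in the extended reals. -/
def GrowthEq {𝒳 : Type*} (σ : 𝒳 → 𝒳) (Λ : ℝ) : Prop :=
  Filter.limsup (growthSeq σ) atTop = ((Real.log Λ : ℝ) : EReal)

/-- The probability that a uniformly chosen general orbit of length at most `X`
satisfies the predicate `Q`. -/
def probN {𝒳 : Type*} (σ : 𝒳 → 𝒳) (X : ℕ) (Q : GenOrbit σ → Prop) : ℝ :=
  (Nat.card {O : GenOrbit σ // genLen O ≤ X ∧ Q O} : ℝ) / (Ncount σ X : ℝ)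

/-- `ω(O)`: the number of distinct prime orbits dividing the general orbit `O`. -/
def omegaCount {𝒳 : Type*} {σ : 𝒳 → 𝒳} (O : GenOrbit σ) : ℕ := O.support.card

/-- A function on general orbits is strongly additive if `g(P^k) = g(P)` for every prime
orbit `P` and `k ≥ 1`, and `g(O₁O₂) = g(O₁) + g(O₂)` for coprime general orbits. -/
def StronglyAdditive {𝒳 : Type*} {σ : 𝒳 → 𝒳} (g : GenOrbit σ → ℝ) : Prop :=
  (∀ (P : PrimeOrbit σ) (k : ℕ), 1 ≤ k →
      g (Finsupp.single P k) = g (Finsupp.single P 1)) ∧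
    ∀ O₁ O₂ : GenOrbit σ, Disjoint O₁.support O₂.support → g (O₁ + O₂) = g O₁ + g O₂

/-- The value of `g` on a prime orbit. -/
def gPrime {𝒳 : Type*} {σ : 𝒳 → 𝒳} (g : GenOrbit σ → ℝ) (P : PrimeOrbit σ) : ℝ :=
  g (Finsupp.single P 1)

/-- Membership in the set `𝒜(X,C)` of prime orbits: either
`k_X = X/exp((log X)^{1/4}) ≤ ℓ(P) ≤ X` or `ℓ(P) < k̃_X = X^{1/log log X}`,
and `|g(P)| ≤ C`. -/
def inTails {𝒳 : Type*} {σ : 𝒳 → 𝒳} (g : GenOrbit σ → ℝ) (C : ℝ) (X : ℕ)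
    (P : PrimeOrbit σ) : Prop :=
  (((X : ℝ) / Real.exp (Real.log (X : ℝ) ^ ((1 : ℝ) / 4)) ≤ (orbitLen P : ℝ) ∧
      orbitLen P ≤ X) ∨
    (orbitLen P : ℝ) < (X : ℝ) ^ (Real.log (Real.log (X : ℝ)))⁻¹) ∧
  |g (Finsupp.single P 1)| ≤ C

lemma abel_sum_le (a : ℕ → ℝ) (D : ℝ) (hD : ∀ n, ∑ k ∈ Finset.Icc 1 n, a k ≤ D * n)
    (hD0 : 0 ≤ D) (m n : ℕ) (ha : ∀ k, 0 ≤ a k) (hm : 1 ≤ m) (hmn : m ≤ n) :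
    ∑ k ∈ Finset.Ioc m n, a k / k ≤ D * (1 + (Real.log n - Real.log m)) := by
  have key : ∑ k ∈ Finset.Ioc m n, a k / k ≤
      (∑ k ∈ Finset.Icc 1 n, a k) / n + D * (Real.log n - Real.log m) := by
    induction n, hmn using Nat.le_induction with
    | base =>
      have : 0 ≤ ∑ k ∈ Finset.Icc 1 m, a k := Finset.sum_nonneg fun k _ => ha k
      simp only [Finset.Ioc_self, Finset.sum_empty, sub_self, mul_zero, add_zero]
      positivity
    | succ n hmn ih =>
      have hn : (0 : ℝ) < n := by exact_mod_cast (by omega : 0 < n)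
      rw [Finset.sum_Ioc_succ_top (by omega), Finset.sum_Icc_succ_top (by omega)]
      set A := ∑ k ∈ Finset.Icc 1 n, a k with hA
      have h1 : A / n - A / (n + 1) ≤ D * (1 / (n + 1)) := by
        have : A / n - A / (n + 1) = A / (n * (n + 1)) := by field_simp; ring
        rw [this, div_le_iff₀ (by positivity)]
        calc A ≤ D * n := hD n
          _ = _ := by field_simp
      have h2 : (1 : ℝ) / (n + 1) ≤ Real.log (n + 1) - Real.log n := by
        rw [← Real.log_div (by positivity) (by positivity)]
        have := Real.one_sub_inv_le_log_of_pos (x := ((n : ℝ) + 1) / n) (by positivity)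
        refine le_trans (le_of_eq ?_) this
        field_simp
        ring
      have h3 := mul_le_mul_of_nonneg_left h2 hD0
      push_cast
      rw [add_div]
      nlinarith
  have hn : (0 : ℝ) < n := by exact_mod_cast (by omega : 0 < n)
  have : (∑ k ∈ Finset.Icc 1 n, a k) / n ≤ D := (div_le_iff₀ hn).2 (hD n)
  linarith

lemma CesaroLim.exists_bound {a : ℕ → ℝ} {B : ℝ} (h : CesaroLim a B) :
    ∃ D : ℝ, 0 < D ∧ ∀ n : ℕ, ∑ k ∈ Finset.Icc 1 n, a k ≤ D * n := by
  obtain ⟨D, hD⟩ := Filter.Tendsto.bddAbove_range h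
  refine ⟨max D 1, by positivity, fun n => ?_⟩
  rcases Nat.eq_zero_or_pos n with rfl | hn
  · simp
  have h1 := hD ⟨n, rfl⟩
  rw [← div_le_iff₀ (by exact_mod_cast hn)]
  exact le_trans h1 (le_max_left _ _)

lemma CesaroLim.eventually_upper_half {a : ℕ → ℝ} {B : ℝ} (h : CesaroLim a B) (hB : 0 < B) :
    ∀ᶠ n : ℕ in atTop, B / 4 * n ≤ ∑ k ∈ Finset.Ioc (n / 2) n, a k := by
  have h1 : ∀ᶠ n : ℕ in atTop, (B - B / 8) < (∑ k ∈ Finset.Icc 1 n, a k) / (n : ℝ) :=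
    h.eventually_const_lt (by linarith)
  have h2 : ∀ᶠ n : ℕ in atTop, (∑ k ∈ Finset.Icc 1 n, a k) / (n : ℝ) < B + B / 8 :=
    h.eventually_lt_const (by linarith)
  have h2' := (Nat.tendsto_div_const_atTop (n := 2) (by norm_num)).eventually h2
  filter_upwards [h1, h2', eventually_ge_atTop 2] with n h1 h2 hn
  have hn0 : (0 : ℝ) < n := by exact_mod_cast (by omega : 0 < n)
  have hn2 : (0 : ℝ) < ((n / 2 : ℕ) : ℝ) := by exact_mod_cast (by omega : 0 < n / 2)
  rw [lt_div_iff₀ hn0] at h1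
  rw [div_lt_iff₀ hn2] at h2
  have h3 : ((n / 2 : ℕ) : ℝ) ≤ n / 2 := by exact_mod_cast Nat.cast_div_le (α := ℝ) (m := n) (n := 2)
  have h4 : ∑ k ∈ Finset.Icc 1 n, a k =
      ∑ k ∈ Finset.Icc 1 (n / 2), a k + ∑ k ∈ Finset.Ioc (n / 2) n, a k := by
    have e : ∀ m : ℕ, Finset.Icc 1 m = Finset.Ioc 0 m := fun m => by ext; simp; omega
    rw [e, e, Finset.sum_Ioc_consecutive _ (by omega) (by omega)]
  nlinarith

lemma exists_polynomial_lower_bound {a H : ℕ → ℝ} {B : ℝ} (ha : ∀ k, 0 ≤ a k)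
    (h : CesaroLim a B) (hB : 0 < B)
    (hH : ∀ n, 0 < H n) (hrec : ∀ n : ℕ, ∑ k ∈ Finset.Icc 1 n, a k * H (n - k) ≤ n * H n) :
    ∃ c K : ℝ, 0 < c ∧ 0 ≤ K ∧ ∀ n : ℕ, c * ((n : ℝ) + 1) ^ (-K) ≤ H n := by
  obtain ⟨n₀, hn₀⟩ := eventually_atTop.1 (h.eventually_upper_half hB)
  set β := min (B / 4) 1 with hβ
  have hβ0 : 0 < β := by positivity
  have hβ1 : β ≤ 1 := min_le_right _ _
  set K := -Real.logb 2 β with hK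
  have hK0 : 0 ≤ K := by
    have := Real.logb_nonpos (b := 2) (by norm_num) hβ0.le hβ1
    linarith
  have h2K : (2 : ℝ) ^ (-K) = β := by
    rw [hK, neg_neg, Real.rpow_logb (by norm_num) (by norm_num) hβ0]
  obtain ⟨c, hc0, hc⟩ : ∃ c : ℝ, 0 < c ∧ ∀ n < n₀ + 1, c ≤ H n := by
    obtain ⟨m, hm, hmin⟩ := Finset.exists_min_image (Finset.range (n₀ + 1)) H ⟨0, by simp⟩
    exact ⟨H m, hH m, fun n hn => hmin n (Finset.mem_range.2 hn)⟩
  refine ⟨c, K, hc0, hK0, fun n => ?_⟩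
  induction n using Nat.strong_induction_on with
  | _ n ih =>
    by_cases hn : n < n₀ + 1
    · have : ((n : ℝ) + 1) ^ (-K) ≤ 1 :=
        Real.rpow_le_one_of_one_le_of_nonpos (by linarith [(Nat.cast_nonneg n : (0 : ℝ) ≤ n)])
          (by linarith)
      nlinarith [hc n hn]
    · have hn0 : (0 : ℝ) < n := by exact_mod_cast (by omega : 0 < n)
      set b := c * (((n : ℝ) + 1) / 2) ^ (-K) with hb
      have hb0 : 0 < b := by positivity
      have hbe : c * ((n : ℝ) + 1) ^ (-K) = β * b := by
        rw [hb, Real.div_rpow (by positivity) (by norm_num), h2K]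
        field_simp
      have h1 : ∑ k ∈ Finset.Ioc (n / 2) n, a k * b ≤ ∑ k ∈ Finset.Icc 1 n, a k * H (n - k) := by
        refine le_trans (Finset.sum_le_sum fun k hk => ?_)
          (Finset.sum_le_sum_of_subset_of_nonneg (s := Finset.Ioc (n / 2) n) ?_ ?_)
        · refine mul_le_mul_of_nonneg_left (le_trans ?_ (ih (n - k) ?_)) (ha k)
          · refine mul_le_mul_of_nonneg_left ?_ hc0.le
            refine Real.rpow_le_rpow_of_nonpos (by positivity) ?_ (by linarith)
            rw [Finset.mem_Ioc] at hk
            rw [le_div_iff₀ (by norm_num)]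
            exact_mod_cast (by omega : (n - k + 1) * 2 ≤ n + 1)
          · rw [Finset.mem_Ioc] at hk
            omega
        · intro k hk
          simp only [Finset.mem_Ioc, Finset.mem_Icc] at *
          omega
        · intro k _ _
          exact mul_nonneg (ha k) (hH _).le
      rw [← Finset.sum_mul] at h1
      have h2 := hn₀ n (by omega)
      have h3 : β * n * b ≤ n * H n := by
        refine le_trans (le_trans ?_ h1) (hrec n)
        refine mul_le_mul_of_nonneg_right (le_trans ?_ h2) hb0.le
        exact mul_le_mul_of_nonneg_right (min_le_left _ _) hn0.le
      rw [hbe]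
      exact le_of_mul_le_mul_left (by linarith) hn0

section Orbits

variable {𝒳 : Type*} {σ : 𝒳 → 𝒳}

lemma PrimeOrbit.len_pos (P : PrimeOrbit σ) : 0 < orbitLen P := by
  obtain ⟨P, x, ℓ, hℓ, hP, hc, hs⟩ := P
  simpa [orbitLen, hc] using hℓ

lemma PrimeOrbit.finite (P : PrimeOrbit σ) : P.1.Finite :=
  Set.finite_of_ncard_pos P.len_pos

lemma PrimeOrbit.exists_eq_range (P : PrimeOrbit σ) :
    ∃ x, σ^[orbitLen P] x = x ∧ P.1 = Set.range fun i => σ^[i] x := by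
  have hfin := P.finite
  obtain ⟨P, x, ℓ, hℓ, hP, hc, hs⟩ := P
  simp only [orbitLen] at *
  rw [hc]
  have hinj : Set.InjOn (fun i => σ^[i] x) (Set.Iio ℓ) := by
    apply Set.injOn_of_ncard_image_eq
    · rw [← hP, hc, Set.ncard_Iio_nat]
    · exact Set.finite_Iio ℓ
  have hσ : Set.InjOn σ P := by
    apply Set.injOn_of_ncard_image_eq _ hfin
    rw [hs]
  have hmem : ∀ i, σ^[i] x ∈ P := by
    intro i
    induction i with
    | zero => rw [hP]; exact ⟨0, hℓ, rfl⟩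
    | succ i ih => rw [Function.iterate_succ_apply', ← hs]; exact ⟨_, ih, rfl⟩
  refine ⟨x, ?_, ?_⟩
  · have h1 := hmem ℓ
    rw [hP] at h1
    obtain ⟨i, hi, h2⟩ := h1
    rcases i with _ | i
    · exact h2.symm
    · obtain ⟨l, rfl⟩ : ∃ l, ℓ = l + 1 := ⟨ℓ - 1, by omega⟩
      simp only [Function.iterate_succ_apply'] at h2
      have h3 := hσ (hmem i) (hmem l) h2
      have h4 := hinj (by simp at hi ⊢; omega) (by simp) h3
      simp at hi
      omega
  · apply Set.Subset.antisymm
    · rw [hP]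
      rintro _ ⟨i, _, rfl⟩
      exact ⟨i, rfl⟩
    · rintro _ ⟨i, rfl⟩
      exact hmem i

lemma PrimeOrbit.eq_range_of_mem (P : PrimeOrbit σ) {y : 𝒳} (hy : y ∈ P.1) :
    σ^[orbitLen P] y = y ∧ P.1 = Set.range fun i => σ^[i] y := by
  obtain ⟨x, hx, hP⟩ := P.exists_eq_range
  have hpos := P.len_pos
  set l := orbitLen P
  rw [hP] at hy ⊢
  obtain ⟨j, rfl⟩ := hy
  refine ⟨?_, ?_⟩
  · simp only
    rw [← Function.iterate_add_apply, add_comm, Function.iterate_add_apply, hx]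
  · ext z
    simp only [Set.mem_range, ← Function.iterate_add_apply]
    constructor
    · rintro ⟨i, rfl⟩
      refine ⟨i + (l - 1) * j, ?_⟩
      have h1 : i + (l - 1) * j + j = i + l * j := by
        obtain ⟨m, hm⟩ : ∃ m, l = m + 1 := ⟨l - 1, by omega⟩
        rw [hm, Nat.add_sub_cancel]
        ring
      rw [h1, Function.iterate_add_apply, Function.iterate_mul, Function.iterate_fixed hx]
    · rintro ⟨i, rfl⟩
      exact ⟨_, rfl⟩

lemma PrimeOrbit.ext_of_mem {P Q : PrimeOrbit σ} {y : 𝒳} (hP : y ∈ P.1) (hQ : y ∈ Q.1) :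
    P = Q :=
  Subtype.ext ((P.eq_range_of_mem hP).2.trans (Q.eq_range_of_mem hQ).2.symm)

lemma exists_primeOrbit_of_periodic {k : ℕ} (hk : 1 ≤ k) {y : 𝒳} (hy : σ^[k] y = y) :
    ∃ P : PrimeOrbit σ, y ∈ P.1 ∧ orbitLen P ∣ k := by
  have hper : Function.IsPeriodicPt σ k y := hy
  have hpos : 0 < Function.minimalPeriod σ y := hper.minimalPeriod_pos hk
  set l := Function.minimalPeriod σ y
  have hly : σ^[l] y = y := Function.isPeriodicPt_minimalPeriod σ y
  have hcard : ((fun i => σ^[i] y) '' Set.Iio l).ncard = l := by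
    rw [Set.InjOn.ncard_image Function.iterate_injOn_Iio_minimalPeriod, Set.ncard_Iio_nat]
  refine ⟨⟨(fun i => σ^[i] y) '' Set.Iio l, y, l, hpos, rfl, hcard, ?_⟩, ⟨0, hpos, rfl⟩, ?_⟩
  · ext z
    constructor
    · rintro ⟨_, ⟨i, hi, rfl⟩, rfl⟩
      by_cases h : i + 1 < l
      · exact ⟨i + 1, h, Function.iterate_succ_apply' _ _ _⟩
      · refine ⟨0, hpos, ?_⟩
        have : i + 1 = l := by simp at hi; omega
        simp only [Function.iterate_zero, id]
        rw [← Function.iterate_succ_apply' (f := σ), Nat.succ_eq_add_one, this, hly]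
    · rintro ⟨i, hi, rfl⟩
      rcases i with _ | i
      · refine ⟨σ^[l - 1] y, ⟨l - 1, by simp; omega, rfl⟩, ?_⟩
        rw [← Function.iterate_succ_apply' (f := σ), Nat.succ_eq_add_one, Nat.sub_add_cancel hpos, hly]
        rfl
      · refine ⟨σ^[i] y, ⟨i, by simp at hi ⊢; omega, rfl⟩, ?_⟩
        exact (Function.iterate_succ_apply' _ _ _).symm
  · simp only [orbitLen]
    rw [hcard]
    exact hper.minimalPeriod_dvd

lemma Confined.finite_len_le (hσ : Confined σ) (X : ℕ) :
    {P : PrimeOrbit σ | orbitLen P ≤ X}.Finite := by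
  have h : (⋃ k ∈ Set.Icc 1 X, {x : 𝒳 | σ^[k] x = x}).Finite :=
    (Set.finite_Icc 1 X).biUnion fun k hk => hσ k hk.1
  refine Set.Finite.of_finite_image (f := Subtype.val) (h.finite_subsets.subset ?_)
    Subtype.val_injective.injOn
  rintro _ ⟨P, hP, rfl⟩ y hy
  simp only [Set.mem_iUnion]
  exact ⟨orbitLen P, ⟨P.len_pos, hP⟩, (P.eq_range_of_mem hy).1⟩

/-- The finite set of prime orbits of length at most `X`. -/
def primesLE (hσ : Confined σ) (X : ℕ) : Finset (PrimeOrbit σ) := (hσ.finite_len_le X).toFinset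

@[simp] lemma mem_primesLE {hσ : Confined σ} {X : ℕ} {P : PrimeOrbit σ} :
    P ∈ primesLE hσ X ↔ orbitLen P ≤ X := by
  simp [primesLE]

lemma mul_orbitLen_le_genLen (O : GenOrbit σ) (P : PrimeOrbit σ) :
    O P * orbitLen P ≤ genLen O := by
  by_cases h : P ∈ O.support
  · exact Finset.single_le_sum (f := fun P => O P * orbitLen P) (fun _ _ => Nat.zero_le _) h
  · simp [Finsupp.notMem_support_iff.1 h]

lemma genLen_add (O₁ O₂ : GenOrbit σ) : genLen (O₁ + O₂) = genLen O₁ + genLen O₂ := by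
  unfold genLen
  exact Finsupp.sum_add_index' (fun _ => by simp) (fun _ _ _ => by ring)

lemma genLen_single (P : PrimeOrbit σ) (m : ℕ) :
    genLen (Finsupp.single P m) = m * orbitLen P := by
  simp [genLen]

lemma apply_le_genLen (O : GenOrbit σ) (P : PrimeOrbit σ) : O P ≤ genLen O :=
  (Nat.le_mul_of_pos_right _ P.len_pos).trans (mul_orbitLen_le_genLen O P)

lemma orbitLen_le_genLen {O : GenOrbit σ} {P : PrimeOrbit σ} (hP : P ∈ O.support) :
    orbitLen P ≤ genLen O :=
  (Nat.le_mul_of_pos_left _ (Nat.pos_of_ne_zero (Finsupp.mem_support_iff.1 hP))).trans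
    (mul_orbitLen_le_genLen O P)

lemma Confined.finite_genLen_le (hσ : Confined σ) (X : ℕ) :
    {O : GenOrbit σ | genLen O ≤ X}.Finite := by
  refine (Finset.finite_toSet
    (Finset.finsupp (primesLE hσ X) fun _ => Finset.range (X + 1))).subset ?_
  intro O hO
  simp only [Set.mem_ofPred_eq] at hO
  simp only [Finset.mem_coe, Finset.mem_finsupp_iff]
  refine ⟨fun P hP => ?_, fun P _ => ?_⟩
  · exact mem_primesLE.2 ((orbitLen_le_genLen hP).trans hO)
  · exact Finset.mem_range_succ_iff.2 ((apply_le_genLen O P).trans hO)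

/-- The finite set of general orbits of length at most `X`. -/
def genLE (hσ : Confined σ) (X : ℕ) : Finset (GenOrbit σ) := (hσ.finite_genLen_le X).toFinset

@[simp] lemma mem_genLE {hσ : Confined σ} {X : ℕ} {O : GenOrbit σ} :
    O ∈ genLE hσ X ↔ genLen O ≤ X := by
  simp [genLE]

lemma Ncount_eq_card (hσ : Confined σ) (X : ℕ) : Ncount σ X = (genLE hσ X).card :=
  Nat.subtype_card _ fun _ => mem_genLE

lemma Ncount_pos (hσ : Confined σ) (X : ℕ) : 0 < Ncount σ X := by
  rw [Ncount_eq_card hσ]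
  exact Finset.card_pos.2 ⟨0, by simp [genLen]⟩

lemma probN_eq (hσ : Confined σ) (X : ℕ) (Q : GenOrbit σ → Prop) :
    probN σ X Q = ((genLE hσ X).filter Q).card / (Ncount σ X : ℝ) := by
  unfold probN
  rw [Nat.subtype_card ((genLE hσ X).filter Q) (by simp)]

lemma card_primes_mul_len_le (hσ : Confined σ) {X k : ℕ} (hk : 1 ≤ k) :
    ((primesLE hσ X).filter fun P => orbitLen P = k).card * k ≤ fixCount σ k := by
  set S := (primesLE hσ X).filter fun P => orbitLen P = k with hS
  have hc : fixCount σ k = (hσ k hk).toFinset.card :=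
    Nat.subtype_card _ (by simp)
  rw [hc]
  have h1 : (S.biUnion fun P => P.finite.toFinset).card = S.card * k := by
    rw [Finset.card_biUnion, Finset.sum_const_nat]
    · intro P hP
      rw [← Set.ncard_eq_toFinset_card _ P.finite]
      exact (Finset.mem_filter.1 hP).2
    · intro P _ Q _ hPQ
      rw [Function.onFun, Finset.disjoint_left]
      intro y hy hy'
      exact hPQ (PrimeOrbit.ext_of_mem (by simpa using hy) (by simpa using hy'))
  rw [← h1]
  refine Finset.card_le_card fun y hy => ?_
  simp only [Finset.mem_biUnion, Set.Finite.mem_toFinset, Set.mem_ofPred_eq] at hy ⊢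
  obtain ⟨P, hP, hy⟩ := hy
  have := (P.eq_range_of_mem hy).1
  rwa [(Finset.mem_filter.1 hP).2] at this

lemma sum_fixCount_mul_Ncount_le (hσ : Confined σ) (X : ℕ) :
    ∑ k ∈ Finset.Icc 1 X, fixCount σ k * Ncount σ (X - k) ≤ X * Ncount σ X := by
  have hc : ∀ (k : ℕ) (hk : 1 ≤ k), fixCount σ k = (hσ k hk).toFinset.card :=
    fun k hk => Nat.subtype_card _ (by simp)
  set F : ℕ → Finset 𝒳 := fun k => if hk : 1 ≤ k then (hσ k hk).toFinset else ∅ with hF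
  have hFm : ∀ k y, y ∈ F k ↔ 1 ≤ k ∧ σ^[k] y = y := by
    intro k y
    by_cases hk : 1 ≤ k <;> simp [hF, hk]
  set S : Finset (Σ _ : ℕ, 𝒳 × GenOrbit σ) :=
    (Finset.Icc 1 X).sigma fun k => F k ×ˢ genLE hσ (X - k) with hS
  have hScard : S.card = ∑ k ∈ Finset.Icc 1 X, fixCount σ k * Ncount σ (X - k) := by
    rw [hS, Finset.card_sigma]
    refine Finset.sum_congr rfl fun k hk => ?_
    have hk1 := (Finset.mem_Icc.1 hk).1
    rw [Finset.card_product, Ncount_eq_card hσ, hc k hk1]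
    simp [hF, hk1]
  have hex : ∀ s : Σ _ : ℕ, 𝒳 × GenOrbit σ, ∃ P : Option (PrimeOrbit σ), s ∈ S →
      ∃ Q, P = some Q ∧ s.2.1 ∈ Q.1 ∧ orbitLen Q ∣ s.1 := by
    intro s
    by_cases hs : s ∈ S
    · simp only [hS, Finset.mem_sigma, Finset.mem_product, hFm] at hs
      obtain ⟨P, h1, h2⟩ := exists_primeOrbit_of_periodic hs.2.1.1 hs.2.1.2
      exact ⟨some P, fun _ => ⟨P, rfl, h1, h2⟩⟩
    · exact ⟨none, fun h => absurd h hs⟩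
  choose p hp using hex
  set f : (Σ _ : ℕ, 𝒳 × GenOrbit σ) → GenOrbit σ := fun s =>
    (p s).elim 0 (fun P => Finsupp.single P (s.1 / orbitLen P)) + s.2.2 with hf
  have hfP : ∀ s ∈ S, ∃ P : PrimeOrbit σ, ∃ j, 1 ≤ j ∧ s.2.1 ∈ P.1 ∧ s.1 = j * orbitLen P ∧
      f s = Finsupp.single P j + s.2.2 := by
    intro s hs
    obtain ⟨P, h1, h2, j, h3⟩ := hp s hs
    refine ⟨P, j, ?_, h2, by rw [h3, mul_comm], ?_⟩
    · rcases Nat.eq_zero_or_pos j with rfl | h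
      · simp [hS] at hs
        omega
      · exact h
    · simp only [hf, h1, Option.elim_some]
      rw [h3, Nat.mul_div_cancel_left _ P.len_pos]
  rw [← hScard, Ncount_eq_card hσ]
  refine Finset.card_le_mul_card_image_of_maps_to (f := f) ?_ X ?_
  · intro s hs
    obtain ⟨P, j, _, _, h3, h4⟩ := hfP s hs
    simp only [hS, Finset.mem_sigma, Finset.mem_product, mem_genLE, Finset.mem_Icc] at hs
    rw [h4, mem_genLE, genLen_add, genLen_single, ← h3]
    omega
  · intro O hO
    set T : Finset (Σ _ : PrimeOrbit σ, ℕ × 𝒳) :=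
      O.support.sigma fun P => Finset.Icc 1 (O P) ×ˢ P.finite.toFinset with hT
    have hTcard : T.card = genLen O := by
      rw [hT, Finset.card_sigma, genLen, Finsupp.sum]
      refine Finset.sum_congr rfl fun P _ => ?_
      rw [Finset.card_product, Nat.card_Icc, ← Set.ncard_eq_toFinset_card _ P.finite]
      simp [orbitLen]
    rw [mem_genLE] at hO
    refine le_trans ?_ (hTcard.trans_le hO)
    have hsurj : ∀ s ∈ S.filter (fun s => f s = O), ∃ t ∈ T,
        s = ⟨t.2.1 * orbitLen t.1, t.2.2, O - Finsupp.single t.1 t.2.1⟩ := by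
      intro s hs
      obtain ⟨hs, hsO⟩ := Finset.mem_filter.1 hs
      obtain ⟨P, j, h1, h2, h3, h4⟩ := hfP s hs
      rw [hsO] at h4
      have hj : j ≤ O P := by simp [h4]
      refine ⟨⟨P, j, s.2.1⟩, ?_, ?_⟩
      · simp only [hT, Finset.mem_sigma, Finset.mem_product, Finset.mem_Icc,
          Set.Finite.mem_toFinset, Finsupp.mem_support_iff]
        exact ⟨by omega, ⟨h1, hj⟩, h2⟩
      · obtain ⟨k, y, O'⟩ := s
        simp only at h3 h4 ⊢
        rw [h3, h4, add_tsub_cancel_left]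
    refine le_trans (Finset.card_le_card (t := T.image fun t =>
      ⟨t.2.1 * orbitLen t.1, t.2.2, O - Finsupp.single t.1 t.2.1⟩) ?_) Finset.card_image_le
    intro s hs
    obtain ⟨t, ht, h⟩ := hsurj s hs
    exact Finset.mem_image.2 ⟨t, ht, h.symm⟩

lemma sum_prod_weight_le (hσ : Confined σ) {q : ℝ} (hq0 : 0 < q) (hq1 : q < 1)
    (z : PrimeOrbit σ → ℝ) (hz : ∀ P, 0 ≤ z P) (X : ℕ) :
    ∑ O ∈ genLE hσ X, (∏ P ∈ O.support, z P) * q ^ genLen O ≤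
      Real.exp ((1 - q)⁻¹ * ∑ P ∈ primesLE hσ X, z P * q ^ orbitLen P) := by
  set w : PrimeOrbit σ → ℕ → ℝ := fun P m => (if m = 0 then 1 else z P) * q ^ (m * orbitLen P)
    with hw
  have hw0 : ∀ P m, 0 ≤ w P m := by
    intro P m
    have := hz P
    simp only [hw]
    split_ifs <;> positivity
  have hterm : ∀ O ∈ genLE hσ X, (∏ P ∈ O.support, z P) * q ^ genLen O =
      ∏ P ∈ primesLE hσ X, w P (O P) := by
    intro O hO
    rw [mem_genLE] at hO
    have hsub : O.support ⊆ primesLE hσ X := fun P hP =>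
      mem_primesLE.2 ((orbitLen_le_genLen hP).trans hO)
    rw [← Finset.prod_subset hsub, genLen, Finsupp.sum, ← Finset.prod_pow_eq_pow_sum,
      ← Finset.prod_mul_distrib]
    · refine Finset.prod_congr rfl fun P hP => ?_
      simp [hw, Finsupp.mem_support_iff.1 hP]
    · intro P _ hP
      simp [hw, Finsupp.notMem_support_iff.1 hP]
  rw [Finset.sum_congr rfl hterm]
  have hle : ∑ O ∈ genLE hσ X, ∏ P ∈ primesLE hσ X, w P (O P) ≤
      ∏ P ∈ primesLE hσ X, ∑ m ∈ Finset.range (X + 1), w P m := by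
    rw [Finset.prod_sum]
    set φ : GenOrbit σ → (∀ P ∈ primesLE hσ X, ℕ) := fun O P _ => O P with hφ
    have hinj : Set.InjOn φ (genLE hσ X) := by
      intro O hO O' hO' h
      ext P
      by_cases hP : P ∈ primesLE hσ X
      · exact congrFun (congrFun h P) hP
      · have h0 : ∀ O ∈ genLE hσ X, O P = 0 := by
          intro O hO
          by_contra hne
          exact hP (mem_primesLE.2 ((orbitLen_le_genLen (Finsupp.mem_support_iff.2 hne)).trans
            (mem_genLE.1 hO)))
        rw [h0 O hO, h0 O' hO']
    calc ∑ O ∈ genLE hσ X, ∏ P ∈ primesLE hσ X, w P (O P)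
        = ∑ O ∈ genLE hσ X, ∏ x ∈ (primesLE hσ X).attach, w x.1 (φ O x.1 x.2) := by
          refine Finset.sum_congr rfl fun O _ => ?_
          exact (Finset.prod_attach _ fun P => w P (O P)).symm
      _ = ∑ r ∈ (genLE hσ X).image φ, ∏ x ∈ (primesLE hσ X).attach, w x.1 (r x.1 x.2) :=
          (Finset.sum_image (f := fun r : ∀ P ∈ primesLE hσ X, ℕ =>
            ∏ x ∈ (primesLE hσ X).attach, w x.1 (r x.1 x.2)) hinj).symm
      _ ≤ _ := by
          refine Finset.sum_le_sum_of_subset_of_nonneg ?_ fun r _ _ =>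
            Finset.prod_nonneg fun x _ => hw0 _ _
          intro r hr
          obtain ⟨O, hO, rfl⟩ := Finset.mem_image.1 hr
          rw [Finset.mem_pi]
          intro P _
          exact Finset.mem_range_succ_iff.2 ((apply_le_genLen O P).trans (mem_genLE.1 hO))
  refine hle.trans ?_
  rw [Finset.mul_sum, Real.exp_sum]
  refine Finset.prod_le_prod (fun P _ => Finset.sum_nonneg fun m _ => hw0 P m) fun P _ => ?_
  have hl := P.len_pos
  have hqℓ1 : q ^ orbitLen P ≤ q := by
    simpa using pow_le_pow_of_le_one hq0.le hq1.le hl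
  have hqℓ0 : 0 < q ^ orbitLen P := pow_pos hq0 _
  set Y := q ^ orbitLen P with hY
  refine le_trans ?_ (Real.add_one_le_exp _)
  rw [Finset.sum_range_succ', add_comm]
  have hgeom : ∑ m ∈ Finset.range X, Y ^ m ≤ (1 - q)⁻¹ := by
    have h := geom_sum_Ico_le_of_lt_one (m := 0) (n := X) hqℓ0.le (hqℓ1.trans_lt hq1)
    rw [Nat.Ico_zero_eq_range, pow_zero, one_div] at h
    exact h.trans (inv_anti₀ (by linarith) (by linarith))
  have hsum : ∑ m ∈ Finset.range X, w P (m + 1) = z P * Y * ∑ m ∈ Finset.range X, Y ^ m := by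
    rw [Finset.mul_sum]
    refine Finset.sum_congr rfl fun m _ => ?_
    simp only [hw, Nat.succ_ne_zero, if_false, hY]
    rw [← pow_mul]
    ring
  have hzero : w P 0 = 1 := by simp [hw]
  rw [hsum, hzero]
  have := mul_le_mul_of_nonneg_left hgeom (mul_nonneg (hz P) hqℓ0.le)
  linarith

end Orbits

lemma sum_primes_le_sum_fixCount {𝒳 : Type*} {σ : 𝒳 → 𝒳} (hσ : Confined σ) {Λ : ℝ} (hΛ : 0 < Λ)
    (X : ℕ) (R : ℕ → Prop) :
    ∑ P ∈ (primesLE hσ X).filter (fun P => R (orbitLen P)), Λ⁻¹ ^ orbitLen P ≤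
      ∑ k ∈ (Finset.Icc 1 X).filter R, (fixCount σ k : ℝ) / Λ ^ k / k := by
  have hmaps : ∀ P ∈ (primesLE hσ X).filter (fun P => R (orbitLen P)),
      orbitLen P ∈ (Finset.Icc 1 X).filter R := by
    intro P hP
    simp only [Finset.mem_filter, mem_primesLE, Finset.mem_Icc] at hP ⊢
    exact ⟨⟨P.len_pos, hP.1⟩, hP.2⟩
  rw [← Finset.sum_fiberwise_of_maps_to hmaps]
  refine Finset.sum_le_sum fun k hk => ?_
  have hk1 : 1 ≤ k := (Finset.mem_Icc.1 (Finset.mem_filter.1 hk).1).1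
  have hk0 : (0 : ℝ) < k := by exact_mod_cast hk1
  calc _ ≤ ∑ P ∈ (primesLE hσ X).filter (fun P => orbitLen P = k), Λ⁻¹ ^ orbitLen P := by
        refine Finset.sum_le_sum_of_subset_of_nonneg (fun P hP => ?_) fun _ _ _ => by positivity
        simp only [Finset.mem_filter] at hP ⊢
        exact ⟨hP.1.1, hP.2⟩
    _ = ((primesLE hσ X).filter fun P => orbitLen P = k).card * Λ⁻¹ ^ k := by
        rw [← nsmul_eq_mul, ← Finset.sum_const]
        exact Finset.sum_congr rfl fun P hP => by rw [(Finset.mem_filter.1 hP).2]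
    _ ≤ _ := by
        rw [le_div_iff₀ hk0, inv_pow, ← div_eq_mul_inv, div_mul_eq_mul_div]
        gcongr
        exact_mod_cast card_primes_mul_len_le hσ hk1

lemma probN_le_chernoff {𝒳 : Type*} {σ : 𝒳 → 𝒳} (hσ : Confined σ) {Λ : ℝ} (hΛ : 1 < Λ) (X : ℕ)
    (Q : GenOrbit σ → Prop) (A : PrimeOrbit σ → Prop) {t r : ℝ} (ht : 0 ≤ t)
    (hQ : ∀ O, Q O → r ≤ ((O.support.filter A).card : ℝ)) :
    probN σ X Q * (Ncount σ X / Λ ^ X) ≤ Real.exp (-(t * r) + (1 - Λ⁻¹)⁻¹ *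
      (∑ P ∈ primesLE hσ X, Λ⁻¹ ^ orbitLen P +
        Real.exp t * ∑ P ∈ (primesLE hσ X).filter A, Λ⁻¹ ^ orbitLen P)) := by
  have hΛ0 : 0 < Λ := by linarith
  have hq0 : 0 < Λ⁻¹ := by positivity
  have hq1 : Λ⁻¹ < 1 := inv_lt_one_of_one_lt₀ hΛ
  have hN : (0 : ℝ) < Ncount σ X := by exact_mod_cast Ncount_pos hσ X
  set z : PrimeOrbit σ → ℝ := fun P => if A P then Real.exp t else 1 with hz
  have hz0 : ∀ P, 0 ≤ z P := by
    intro P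
    simp only [hz]
    split_ifs <;> positivity
  have hprod : ∀ O : GenOrbit σ, ∏ P ∈ O.support, z P =
      Real.exp (t * (O.support.filter A).card) := by
    intro O
    simp only [hz]
    rw [← Finset.prod_filter, Finset.prod_const, ← Real.exp_nat_mul, mul_comm]
  have hmain := sum_prod_weight_le hσ hq0 hq1 z hz0 X
  have hlow : ((genLE hσ X).filter Q).card * (Real.exp (t * r) * Λ⁻¹ ^ X) ≤
      ∑ O ∈ genLE hσ X, (∏ P ∈ O.support, z P) * Λ⁻¹ ^ genLen O := by
    rw [← nsmul_eq_mul, ← Finset.sum_const]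
    refine le_trans (Finset.sum_le_sum fun O hO => ?_)
      (Finset.sum_le_sum_of_subset_of_nonneg (Finset.filter_subset Q _) fun O _ _ =>
        mul_nonneg (Finset.prod_nonneg fun P _ => hz0 P) (by positivity))
    obtain ⟨hO, hOQ⟩ := Finset.mem_filter.1 hO
    rw [hprod]
    have h1 := mul_le_mul_of_nonneg_left (hQ O hOQ) ht
    have h2 : Λ⁻¹ ^ X ≤ Λ⁻¹ ^ genLen O := pow_le_pow_of_le_one hq0.le hq1.le (mem_genLE.1 hO)
    gcongr
  have hsum : ∑ P ∈ primesLE hσ X, z P * Λ⁻¹ ^ orbitLen P ≤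
      ∑ P ∈ primesLE hσ X, Λ⁻¹ ^ orbitLen P +
        Real.exp t * ∑ P ∈ (primesLE hσ X).filter A, Λ⁻¹ ^ orbitLen P := by
    rw [Finset.mul_sum, Finset.sum_filter, ← Finset.sum_add_distrib]
    refine Finset.sum_le_sum fun P _ => ?_
    have : 0 < Λ⁻¹ ^ orbitLen P := by positivity
    simp only [hz]
    split_ifs <;> linarith
  have hinv : 0 ≤ (1 - Λ⁻¹)⁻¹ := inv_nonneg.2 (by linarith)
  have h := (hlow.trans hmain).trans
    (Real.exp_le_exp.2 (mul_le_mul_of_nonneg_left hsum hinv))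
  rw [probN_eq hσ, Real.exp_add, Real.exp_neg, ← div_eq_inv_mul, le_div_iff₀ (Real.exp_pos _)]
  refine le_trans (le_of_eq ?_) h
  rw [inv_pow]
  field_simp

lemma sum_tail_le {a : ℕ → ℝ} {D : ℝ} (ha : ∀ k, 0 ≤ a k) (hD0 : 0 ≤ D)
    (hD : ∀ n : ℕ, ∑ k ∈ Finset.Icc 1 n, a k ≤ D * n) {x : ℝ} {X : ℕ} (hx : 2 ≤ x)
    (hxX : x ≤ X) :
    ∑ k ∈ (Finset.Icc 1 X).filter (fun k : ℕ => x ≤ k), a k / k ≤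
      D * (2 + Real.log X - Real.log x) := by
  have hceil : 2 ≤ ⌈x⌉₊ := by exact_mod_cast hx.trans (Nat.le_ceil x)
  have hm : x / 2 ≤ ((⌈x⌉₊ - 1 : ℕ) : ℝ) := by
    rw [Nat.cast_sub (by omega)]
    have := Nat.le_ceil x
    push_cast
    linarith
  have hmX : ⌈x⌉₊ - 1 ≤ X := (Nat.sub_le _ _).trans (Nat.ceil_le.2 hxX)
  have h1 := abel_sum_le a D hD hD0 (⌈x⌉₊ - 1) X ha (by omega) hmX
  have h2 := Real.log_le_log (by linarith) hm
  rw [Real.log_div (by linarith) (by norm_num)] at h2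
  have h3 : Real.log 2 ≤ 1 := by linarith [Real.log_two_lt_d9]
  refine le_trans (Finset.sum_le_sum_of_subset_of_nonneg (fun k hk => ?_) fun k _ _ =>
    div_nonneg (ha k) (Nat.cast_nonneg k)) (h1.trans (mul_le_mul_of_nonneg_left ?_ hD0))
  · simp only [Finset.mem_filter, Finset.mem_Icc, Finset.mem_Ioc] at hk ⊢
    have := Nat.ceil_le.2 hk.2
    omega
  · linarith

lemma sum_head_le {a : ℕ → ℝ} {D : ℝ} (ha : ∀ k, 0 ≤ a k) (hD0 : 0 ≤ D)
    (hD : ∀ n : ℕ, ∑ k ∈ Finset.Icc 1 n, a k ≤ D * n) {y : ℝ} (hy : 1 ≤ y) (X : ℕ) :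
    ∑ k ∈ (Finset.Icc 1 X).filter (fun k : ℕ => (k : ℝ) ≤ y), a k / k ≤
      D * (2 + Real.log y) := by
  have hfl : 1 ≤ ⌊y⌋₊ := Nat.one_le_floor_iff y |>.2 hy
  have h1 := abel_sum_le a D hD hD0 1 ⌊y⌋₊ ha le_rfl hfl
  have h2 : Real.log ⌊y⌋₊ ≤ Real.log y :=
    Real.log_le_log (by exact_mod_cast hfl) (Nat.floor_le (by linarith))
  have h3 : a 1 ≤ D := by simpa using hD 1
  have h4 : ∑ k ∈ Finset.Icc 1 ⌊y⌋₊, a k / k = a 1 + ∑ k ∈ Finset.Ioc 1 ⌊y⌋₊, a k / k := by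
    rw [← Finset.sum_Ioc_add_eq_sum_Icc hfl]
    simp [add_comm]
  have h5 : ∑ k ∈ (Finset.Icc 1 X).filter (fun k : ℕ => (k : ℝ) ≤ y), a k / k ≤
      ∑ k ∈ Finset.Icc 1 ⌊y⌋₊, a k / k := by
    refine Finset.sum_le_sum_of_subset_of_nonneg (fun k hk => ?_) fun k _ _ =>
      div_nonneg (ha k) (Nat.cast_nonneg k)
    simp only [Finset.mem_filter, Finset.mem_Icc] at hk ⊢
    exact ⟨hk.1.1, Nat.le_floor hk.2⟩
  simp only [Nat.cast_one, Real.log_one, sub_zero] at h1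
  nlinarith

lemma isLittleO_tail_exponent (c E : ℝ) :
    (fun L : ℝ => c + E * (4 + L ^ ((1 : ℝ) / 4) + L / Real.log L)) =o[atTop] fun L : ℝ => L := by
  have hconst : ∀ c : ℝ, (fun _ : ℝ => c) =o[atTop] fun L : ℝ => L :=
    fun c => isLittleO_const_id_atTop c
  have h1 : (fun L : ℝ => L ^ ((1 : ℝ) / 4)) =o[atTop] fun L : ℝ => L := by
    refine (isLittleO_iff_tendsto' ?_).2 ?_
    · filter_upwards [eventually_gt_atTop 0] with L hL h
      exact absurd h hL.ne'
    · refine (tendsto_rpow_neg_atTop (y := (3 : ℝ) / 4) (by norm_num)).congr' ?_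
      filter_upwards [eventually_gt_atTop 0] with L hL
      rw [← Real.rpow_sub_one hL.ne']
      norm_num
  have h2 : (fun L : ℝ => L / Real.log L) =o[atTop] fun L : ℝ => L := by
    refine (isLittleO_iff_tendsto' ?_).2 ?_
    · filter_upwards [eventually_gt_atTop 0] with L hL h
      exact absurd h hL.ne'
    · refine (Real.tendsto_log_atTop.inv_tendsto_atTop).congr' ?_
      filter_upwards [eventually_gt_atTop 0] with L hL
      simp only [Pi.inv_apply]
      field_simp
  exact (hconst c).add ((((hconst 4).add h1).add h2).const_mul_left E)

lemma eventually_log_probN_le {𝒳 : Type*} {σ : 𝒳 → 𝒳} (hσ : Confined σ) {Λ B : ℝ} (hΛ : 1 < Λ)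
    (hB : CesaroLim (fun k => (fixCount σ k : ℝ) / Λ ^ k) B) (hBpos : 0 < B)
    (g : GenOrbit σ → ℝ) {C ε : ℝ} (hC : 0 < C) (hε : 0 < ε) (M : ℝ) :
    ∀ᶠ X : ℕ in atTop,
      let p := probN σ X fun O =>
        ε * (B * Real.log (X : ℝ)) ≤
          |∑ P ∈ O.support.filter (fun P => inTails g C X P), gPrime g P|
      0 < p → Real.log p ≤ M * (B * Real.log (X : ℝ)) := by
  have hΛ0 : 0 < Λ := by linarith
  set a : ℕ → ℝ := fun k => (fixCount σ k : ℝ) / Λ ^ k with ha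
  have ha0 : ∀ k, 0 ≤ a k := fun k => by positivity
  obtain ⟨D, hD0, hD⟩ := hB.exists_bound
  have hNpos : ∀ n, (0 : ℝ) < Ncount σ n := fun n => by exact_mod_cast Ncount_pos hσ n
  obtain ⟨c, K, hc, hK, hlow⟩ := exists_polynomial_lower_bound (a := a)
    (H := fun n => (Ncount σ n : ℝ) / Λ ^ n) ha0 hB hBpos
    (fun n => div_pos (hNpos n) (by positivity)) (by
      intro n
      have h : (∑ k ∈ Finset.Icc 1 n, (fixCount σ k : ℝ) * Ncount σ (n - k)) ≤
          n * Ncount σ n := by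
        exact_mod_cast sum_fixCount_mul_Ncount_le hσ n
      rw [← mul_div_assoc, le_div_iff₀ (by positivity), Finset.sum_mul]
      refine le_trans (Finset.sum_le_sum fun k hk => le_of_eq ?_) h
      have hkn := (Finset.mem_Icc.1 hk).2
      have : Λ ^ n = Λ ^ k * Λ ^ (n - k) := by rw [← pow_add, Nat.add_sub_cancel' hkn]
      simp only [ha]
      rw [this]
      field_simp)
  set δ := (1 - Λ⁻¹)⁻¹ with hδ
  have hδ0 : 0 ≤ δ := inv_nonneg.2 (by linarith [inv_lt_one_of_one_lt₀ hΛ])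
  set t := (K + δ * D + B * (|M| + 1)) * C / (ε * B) with ht
  have ht0 : 0 ≤ t := by positivity
  have hw := ((isLittleO_tail_exponent (-Real.log c + K + δ * (2 * D)) (δ * Real.exp t * D)).bound
    hBpos)
  have hroot := (isLittleO_tail_exponent 0 1).bound (c := 1 / 2) (by norm_num)
  have hlogX : Tendsto (fun X : ℕ => Real.log (X : ℝ)) atTop atTop :=
    Real.tendsto_log_atTop.comp tendsto_natCast_atTop_atTop
  filter_upwards [hlogX.eventually hw, hlogX.eventually hroot, hlogX.eventually_ge_atTop 3,
    eventually_ge_atTop 1] with X hw hroot hL hX p hp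
  have hX0 : (0 : ℝ) < X := by exact_mod_cast hX
  have hX1 : (1 : ℝ) ≤ X := by exact_mod_cast hX
  set L := Real.log (X : ℝ) with hLdef
  have hlogL : 0 < Real.log L := Real.log_pos (by linarith)
  set ρ := L ^ ((1 : ℝ) / 4) with hρ
  have hρ0 : 0 ≤ ρ := by positivity
  have hs0 : 0 ≤ L / Real.log L := by positivity
  have hL0 : |L| = L := abs_of_nonneg (by linarith)
  rw [Real.norm_eq_abs, Real.norm_eq_abs, hL0] at hw hroot
  replace hw := (le_abs_self _).trans hw
  replace hroot := (le_abs_self _).trans hroot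
  have hexpX : (X : ℝ) / Real.exp ρ = Real.exp (L - ρ) := by
    rw [Real.exp_sub, hLdef, Real.exp_log hX0]
  have hlogx : Real.log ((X : ℝ) / Real.exp ρ) = L - ρ := by rw [hexpX, Real.log_exp]
  have hx2 : 2 ≤ (X : ℝ) / Real.exp ρ := by
    rw [hexpX]
    linarith [Real.add_one_le_exp (L - ρ)]
  have hxX : (X : ℝ) / Real.exp ρ ≤ X := div_le_self hX0.le (Real.one_le_exp hρ0)
  have hy1 : 1 ≤ (X : ℝ) ^ (Real.log L)⁻¹ := Real.one_le_rpow hX1 (inv_nonneg.2 hlogL.le)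
  have hlogy : Real.log ((X : ℝ) ^ (Real.log L)⁻¹) = L / Real.log L := by
    rw [Real.log_rpow hX0, div_eq_inv_mul]
  have htail := sum_tail_le ha0 hD0.le hD hx2 hxX
  have hhead := sum_head_le ha0 hD0.le hD hy1 X
  have hall := sum_head_le ha0 hD0.le hD hX1 X
  rw [hlogx] at htail
  rw [hlogy] at hhead
  have hA : ∑ P ∈ (primesLE hσ X).filter (fun P => inTails g C X P), Λ⁻¹ ^ orbitLen P ≤
      D * (4 + ρ + L / Real.log L) := by
    have h1 := sum_primes_le_sum_fixCount hσ hΛ0 X fun k => (X : ℝ) / Real.exp ρ ≤ k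
    have h2 := sum_primes_le_sum_fixCount hσ hΛ0 X fun k => (k : ℝ) ≤ (X : ℝ) ^ (Real.log L)⁻¹
    have h3 : (primesLE hσ X).filter (fun P => inTails g C X P) ⊆
        (primesLE hσ X).filter (fun P => (X : ℝ) / Real.exp ρ ≤ orbitLen P) ∪
        (primesLE hσ X).filter (fun P => (orbitLen P : ℝ) ≤ (X : ℝ) ^ (Real.log L)⁻¹) := by
      intro P hP
      obtain ⟨hP, hPt⟩ := Finset.mem_filter.1 hP
      rw [Finset.mem_union, Finset.mem_filter, Finset.mem_filter]
      rcases hPt.1 with h | h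
      · exact Or.inl ⟨hP, h.1⟩
      · exact Or.inr ⟨hP, h.le⟩
    have h4 : ∑ P ∈ (primesLE hσ X).filter (fun P => inTails g C X P), Λ⁻¹ ^ orbitLen P ≤ _ :=
      Finset.sum_le_sum_of_subset_of_nonneg h3 fun _ _ _ => by positivity
    have h5 := Finset.sum_union_inter (f := fun P : PrimeOrbit σ => Λ⁻¹ ^ orbitLen P)
      (s₁ := (primesLE hσ X).filter (fun P => (X : ℝ) / Real.exp ρ ≤ orbitLen P))
      (s₂ := (primesLE hσ X).filter (fun P => (orbitLen P : ℝ) ≤ (X : ℝ) ^ (Real.log L)⁻¹))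
    have h6 : 0 ≤ ∑ P ∈ (primesLE hσ X).filter (fun P => (X : ℝ) / Real.exp ρ ≤ orbitLen P) ∩
        (primesLE hσ X).filter (fun P => (orbitLen P : ℝ) ≤ (X : ℝ) ^ (Real.log L)⁻¹),
        Λ⁻¹ ^ orbitLen P := Finset.sum_nonneg fun _ _ => by positivity
    linarith
  have hS : ∑ P ∈ primesLE hσ X, Λ⁻¹ ^ orbitLen P ≤ D * (2 + L) := by
    have h1 := sum_primes_le_sum_fixCount hσ hΛ0 X fun k => (k : ℝ) ≤ X
    rw [Finset.filter_true_of_mem fun P hP => by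
      exact_mod_cast mem_primesLE.1 hP] at h1
    exact h1.trans hall
  have hQ : ∀ O : GenOrbit σ, ε * (B * L) ≤
      |∑ P ∈ O.support.filter (fun P => inTails g C X P), gPrime g P| →
      ε * (B * L) / C ≤ ((O.support.filter fun P => inTails g C X P).card : ℝ) := by
    intro O hO
    rw [div_le_iff₀ hC]
    refine hO.trans ((Finset.abs_sum_le_sum_abs _ _).trans ?_)
    rw [← nsmul_eq_mul]
    exact Finset.sum_le_card_nsmul _ _ _ fun P hP => (Finset.mem_filter.1 hP).2.2
  have hch := probN_le_chernoff hσ hΛ X _ (fun P => inTails g C X P) ht0 hQ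
  have hH := hlow X
  have hX1' : (0 : ℝ) < (X : ℝ) + 1 := by linarith
  have hpH : p * (c * ((X : ℝ) + 1) ^ (-K)) ≤ _ :=
    (mul_le_mul_of_nonneg_left hH hp.le).trans hch
  have hlog := Real.log_le_log (by positivity) hpH
  rw [Real.log_exp, Real.log_mul hp.ne' (by positivity),
    Real.log_mul hc.ne' (by positivity), Real.log_rpow hX1'] at hlog
  have hX2 : Real.log ((X : ℝ) + 1) ≤ L + 1 := by
    have h1 : Real.log ((X : ℝ) + 1) ≤ Real.log (2 * X) := Real.log_le_log hX1' (by linarith)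
    rw [Real.log_mul (by norm_num) hX0.ne'] at h1
    linarith [Real.log_two_lt_d9]
  have h1 := mul_le_mul_of_nonneg_left hX2 hK
  have h2 := mul_le_mul_of_nonneg_left
    (add_le_add hS (mul_le_mul_of_nonneg_left hA (Real.exp_pos t).le)) hδ0
  have h3 : t * (ε * (B * L) / C) = (K + δ * D + B * (|M| + 1)) * L := by
    rw [ht]
    field_simp
  have h4 : -|M| * (B * L) ≤ M * (B * L) :=
    mul_le_mul_of_nonneg_right (neg_abs_le M) (by positivity)
  rw [h3] at hlog
  refine le_trans ?_ h4
  linarith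

/-- Lemma: prime orbits in `𝒜(X,C)` contribute negligibly on the large deviation scale:
for every `C > 0` and `ε > 0`,
`limsup_{X→∞} (1/(B log X)) log ℙ_X[ |Σ_{P ∈ 𝒜(X,C), P ∣ O} g(P)| ≥ ε B log X ] = -∞`. -/
theorem tails_negligible {𝒳 : Type*} (σ : 𝒳 → 𝒳) (hσ : Confined σ)
    (Λ B : ℝ) (hΛfin : GrowthEq σ Λ) (hΛ : 1 < Λ)
    (hB : CesaroLim (fun k => (fixCount σ k : ℝ) / Λ ^ k) B) (hBpos : 0 < B)
    (g : GenOrbit σ → ℝ) (hg : StronglyAdditive g)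
    (C ε : ℝ) (hC : 0 < C) (hε : 0 < ε) :
    Filter.limsup (fun X : ℕ =>
      ((((B * Real.log (X : ℝ))⁻¹ : ℝ) : EReal) *
        elog (probN σ X fun O =>
          ε * (B * Real.log (X : ℝ)) ≤
            |∑ P ∈ O.support.filter (fun P => inTails g C X P), gPrime g P|))) atTop
      = (⊥ : EReal) := by
  rw [EReal.eq_bot_iff_forall_lt]
  intro M
  refine lt_of_le_of_lt (b := ((M - 1 : ℝ) : EReal)) ?_ (by exact_mod_cast sub_one_lt M)
  refine Filter.limsup_le_of_le (by isBoundedDefault) ?_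
  have hlogX : Tendsto (fun X : ℕ => Real.log (X : ℝ)) atTop atTop :=
    Real.tendsto_log_atTop.comp tendsto_natCast_atTop_atTop
  filter_upwards [eventually_log_probN_le hσ hΛ hB hBpos g hC hε (M - 1),
    hlogX.eventually_gt_atTop 0] with X hX hL
  have hBL : 0 < B * Real.log (X : ℝ) := by positivity
  unfold elog
  split_ifs with hp
  · rw [EReal.coe_mul_bot_of_pos (inv_pos.2 hBL)]
    exact bot_le
  · rw [← EReal.coe_mul, EReal.coe_le_coe_iff, ← div_eq_inv_mul, div_le_iff₀ hBL]
    exact hX (not_le.1 hp)
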